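/- Let G_n(σ,τ) = n/2 − C([σ,τ])/2 + 1 where σ, τ are independent uniform random elements of S_n. Then Var[G_n] − log(n)/4 converges to γ/4 − π²/24 as n → ∞; i.e. Var[G_n] = log(n)/4 + γ/4 − π²/24 + o(1). -/

import Mathlib

/-- Number of cycles of a permutation of `Fin n`, counting fixed points as 1-cycles. -/
def numCycles {n : ℕ} (π : Equiv.Perm (Fin n)) : ℕ :=
  Multiset.card π.cycleType + (Finset.univ.filter fun i => π i = i).card

/-- Expectation with respect to the uniform measure on `S_n × S_n`. -/
noncomputable def expect (n : ℕ) (f : Equiv.Perm (Fin n) × Equiv.Perm (Fin n) → ℝ) : ℝ :=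
  (∑ p : Equiv.Perm (Fin n) × Equiv.Perm (Fin n), f p) / (n.factorial : ℝ) ^ 2

/-- The random variable `G_n(σ,τ) = n/2 - C([σ,τ])/2 + 1`. -/
noncomputable def genusRV (n : ℕ) (p : Equiv.Perm (Fin n) × Equiv.Perm (Fin n)) : ℝ :=
  (n : ℝ) / 2 - (numCycles (p.1 * p.2 * p.1⁻¹ * p.2⁻¹) : ℝ) / 2 + 1

section
open Equiv

theorem card_quot {n : ℕ} (π : Perm (Fin n)) :
    Nat.card (Quotient (Perm.SameCycle.setoid π)) = numCycles π := by
  classical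
  have e : Quotient (Perm.SameCycle.setoid π) ≃
      {c // c ∈ π.cycleFactorsFinset} ⊕ {i // i ∈ Finset.univ.filter fun i => π i = i} := by
    refine Equiv.ofBijective (Quotient.lift (fun x => if h : π x = x then Sum.inr ⟨x, by simp [h]⟩
      else Sum.inl ⟨π.cycleOf x, by
        rw [Perm.cycleOf_mem_cycleFactorsFinset_iff, Perm.mem_support]; exact h⟩) ?_) ⟨?_, ?_⟩
    · intro a b hab
      have hab : π.SameCycle a b := hab
      by_cases h : π a = a
      · have : a = b := by
          obtain ⟨i, hi⟩ := hab
          rw [← hi, Perm.zpow_apply_eq_self_of_apply_eq_self h]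
        subst this; rfl
      · have h2 : ¬ π b = b := by
          intro hb; apply h
          exact (hab.apply_eq_self_iff).2 hb
        simp only [h, h2, dite_false]
        congr 2
        exact hab.cycleOf_eq
    · intro a b
      induction a using Quotient.inductionOn with | _ a
      induction b using Quotient.inductionOn with | _ b
      simp only [Quotient.lift_mk]
      split_ifs with h1 h2 h2
      · intro h
        simp at h
        rw [h]
      · simp
      · simp
      · intro h
        simp at h
        apply Quotient.sound
        show π.SameCycle a b
        rw [Perm.sameCycle_iff_cycleOf_eq_of_mem_support (by simpa using h1) (by simpa using h2)]
        exact h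
    · rintro (⟨c, hc⟩ | ⟨i, hi⟩)
      · have hc' := hc
        rw [Perm.mem_cycleFactorsFinset_iff] at hc'
        obtain ⟨x, hx⟩ := hc'.1.nonempty_support
        refine ⟨Quotient.mk _ x, ?_⟩
        have hx2 := Perm.mem_cycleFactorsFinset_support_le hc hx
        have : ¬ π x = x := by simpa using hx2
        simp only [Quotient.lift_mk, this, dite_false]
        congr 2
        exact (Perm.cycle_is_cycleOf hx hc).symm
      · refine ⟨Quotient.mk _ i, ?_⟩
        simp at hi
        simp [hi]
  rw [Nat.card_congr e, Nat.card_sum, Nat.card_eq_fintype_card, Nat.card_eq_fintype_card,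
    Fintype.card_coe, Fintype.card_coe, numCycles, Perm.cycleType_def, Multiset.card_map]
  rfl

theorem perm_inv_zpow {n : ℕ} (π : Perm (Fin n)) (f : Fin n → Bool) (h : ∀ x, f (π x) = f x)
    (i : ℤ) (x : Fin n) : f ((π ^ i) x) = f x := by
  induction i using Int.induction_on generalizing x with
  | zero => simp
  | succ i ih => rw [zpow_add_one, Perm.mul_apply, ih, h]
  | pred i ih => rw [zpow_sub_one, Perm.mul_apply, ih, ← h]; simp

theorem card_inv {n : ℕ} (π : Perm (Fin n)) :
    Nat.card {f : Fin n → Bool // ∀ x, f (π x) = f x} = 2 ^ numCycles π := by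
  classical
  have e : {f : Fin n → Bool // ∀ x, f (π x) = f x} ≃
      (Quotient (Perm.SameCycle.setoid π) → Bool) :=
    { toFun := fun f => Quotient.lift f.1 (by
        rintro a b ⟨i, hi⟩
        rw [← hi, perm_inv_zpow π f.1 f.2])
      invFun := fun g => ⟨fun x => g (Quotient.mk _ x), fun x => by
        refine congrArg g ?_
        apply Quotient.sound
        show π.SameCycle _ _
        exact Perm.sameCycle_apply_left.2 (Perm.SameCycle.refl _ _)⟩
      left_inv := fun f => by ext x; rfl
      right_inv := fun g => by
        ext x
        induction x using Quotient.inductionOn with | _ a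
        rfl }
  rw [Nat.card_congr e, Nat.card_fun, card_quot]
  simp

theorem numCycles_swap_mul {n : ℕ} (ρ : Perm (Fin n)) (j k : Fin n) (hk : ρ k = k) (hjk : j ≠ k) :
    numCycles (swap j k * ρ) + 1 = numCycles ρ := by
  classical
  have e : {f : Fin n → Bool // ∀ x, f (ρ x) = f x} ≃
      {f : Fin n → Bool // ∀ x, f ((swap j k * ρ) x) = f x} × Bool :=
    { toFun := fun f => (⟨fun x => if x = k then f.1 j else f.1 x, fun x => by
          by_cases h1 : x = k
          · subst h1; simp [hk, hjk]
          · have h2 : ρ x ≠ k := fun h => h1 (ρ.injective (h.trans hk.symm))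
            by_cases h3 : ρ x = j
            · simp [h3, h1, ← f.2 x]
            · simp [swap_apply_of_ne_of_ne h3 h2, h1, h2, f.2]⟩, f.1 k)
      invFun := fun g => ⟨fun x => if x = k then g.2 else g.1.1 x, fun x => by
          have hg := g.1.2
          by_cases h1 : x = k
          · subst h1; simp [hk]
          · have h2 : ρ x ≠ k := fun h => h1 (ρ.injective (h.trans hk.symm))
            by_cases h3 : ρ x = j
            · have := hg x
              have h4 := hg k
              simp [hk, h3] at this h4
              simp [h3, h1, hjk, ← this, h4]
            · have := hg x
              simp [swap_apply_of_ne_of_ne h3 h2] at this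
              simp [h1, h2, this]⟩
      left_inv := fun f => by
        ext x
        by_cases h : x = k <;> simp [h]
      right_inv := fun g => by
        have h4 := g.1.2 k
        simp [hk] at h4
        ext x
        · by_cases h : x = k <;> simp [h, hjk, h4]
        · simp }
  have := Nat.card_congr e
  rw [Nat.card_prod, card_inv, card_inv, Nat.card_eq_fintype_card, Fintype.card_bool,
    ← pow_succ] at this
  exact (Nat.pow_right_injective (le_refl 2) this).symm

theorem numCycles_conj {n : ℕ} (g π : Perm (Fin n)) : numCycles (g * π * g⁻¹) = numCycles π := by
  unfold numCycles
  rw [Perm.cycleType_conj]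
  congr 1
  apply Finset.card_bij' (fun i _ => g⁻¹ i) (fun i _ => g i)
  · intro i hi
    have h1 : g (π (g⁻¹ i)) = i := (Finset.mem_filter.1 hi).2
    refine Finset.mem_filter.2 ⟨Finset.mem_univ _, ?_⟩
    rw [Perm.eq_inv_iff_eq]; exact h1
  · intro i hi
    have h1 : π i = i := (Finset.mem_filter.1 hi).2
    refine Finset.mem_filter.2 ⟨Finset.mem_univ _, ?_⟩
    simp [h1]
  · simp
  · simp

theorem numCycles_one {n : ℕ} : numCycles (1 : Perm (Fin n)) = n := by
  simp [numCycles]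
end

section
open Equiv

abbrev GA (n : ℕ) := MonoidAlgebra ℝ (Perm (Fin n))

noncomputable abbrev dl {n : ℕ} (g : Perm (Fin n)) : GA n := MonoidAlgebra.of ℝ (Perm (Fin n)) g

/-- Permutations fixing all points `≥ k`. -/
def lowS (n k : ℕ) : Finset (Perm (Fin n)) :=
  Finset.univ.filter fun π => ∀ j : Fin n, k ≤ j.val → π j = j

theorem mem_lowS {n k : ℕ} {π : Perm (Fin n)} :
    π ∈ lowS n k ↔ ∀ j : Fin n, k ≤ j.val → π j = j := by simp [lowS]

noncomputable def Uk (n k : ℕ) (x : ℝ) : GA n := ∑ π ∈ lowS n k, x ^ numCycles π • dl π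

noncomputable def Phi (n : ℕ) (x : ℝ) : GA n := ∑ π : Perm (Fin n), x ^ numCycles π • dl π

noncomputable def JM {n : ℕ} (k : Fin n) : GA n := ∑ j ∈ Finset.Iio k, dl (swap j k)

theorem Uk_zero (n : ℕ) (x : ℝ) : Uk n 0 x = x ^ n • (1 : GA n) := by
  have : lowS n 0 = {1} := by
    ext π; rw [mem_lowS, Finset.mem_singleton]
    constructor
    · intro h; ext j; rw [h j (Nat.zero_le _)]; rfl
    · rintro rfl; simp
  rw [Uk, this, Finset.sum_singleton, numCycles_one]
  simp [MonoidAlgebra.one_def]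

theorem Uk_top (n : ℕ) (x : ℝ) : Uk n n x = Phi n x := by
  have : lowS n n = Finset.univ := by
    ext π; rw [mem_lowS]
    constructor
    · simp
    · intro _ j hj; exact absurd j.isLt (by omega)
  rw [Uk, this, Phi]

theorem Uk_succ {n : ℕ} (k : Fin n) (x : ℝ) :
    x • Uk n (k.val + 1) x = (x • (1 : GA n) + JM k) * Uk n k.val x := by
  classical
  have key : ∑ π ∈ lowS n (k.val + 1), x ^ (numCycles π + 1) • dl π =
      ∑ p ∈ Finset.Iic k ×ˢ lowS n k.val, x ^ (numCycles (swap p.1 k * p.2) + 1) •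
        dl (swap p.1 k * p.2) := by
    symm
    apply Finset.sum_bij' (fun p _ => swap p.1 k * p.2) (fun π _ => (π k, swap (π k) k * π))
    · rintro ⟨j, ρ⟩ h
      simp only [Finset.mem_product, Finset.mem_Iic, mem_lowS] at h ⊢
      intro i hi
      rw [Perm.mul_apply, h.2 i (by omega)]
      apply swap_apply_of_ne_of_ne
      · rintro rfl; have := h.1; rw [Fin.le_def] at this; omega
      · rintro rfl; omega
    · intro π h
      simp only [Finset.mem_product, Finset.mem_Iic, mem_lowS] at h ⊢
      constructor
      · by_contra hc
        rw [not_le, Fin.lt_def] at hc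
        have := h (π k) (by omega)
        have := π.injective this
        rw [this] at hc; omega
      · intro i hi
        rw [Perm.mul_apply]
        by_cases hik : i = k
        · subst hik; simp
        · have : i.val ≠ k.val := fun h => hik (Fin.ext h)
          rw [h i (by omega)]
          apply swap_apply_of_ne_of_ne
          · intro h2
            apply hik
            apply π.injective
            rw [h i (by omega)]; exact h2
          · exact hik
    · rintro ⟨j, ρ⟩ h
      simp only [Finset.mem_product, Finset.mem_Iic, mem_lowS] at h
      have hk := h.2 k le_rfl
      simp [hk, ← mul_assoc]
    · intro π h
      simp [← mul_assoc]
    · rintro ⟨j, ρ⟩ h; rfl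
  have h1 : x • Uk n (k.val + 1) x = ∑ π ∈ lowS n (k.val + 1), x ^ (numCycles π + 1) • dl π := by
    rw [Uk, Finset.smul_sum]
    refine Finset.sum_congr rfl fun π _ => ?_
    rw [smul_smul, pow_succ']
  rw [h1, key, Finset.sum_product, ← Finset.Iio_insert, Finset.sum_insert (by simp), add_mul]
  congr 1
  · rw [Uk, Finset.mul_sum]
    refine Finset.sum_congr rfl fun π _ => ?_
    simp only [swap_self]
    rw [pow_succ', smul_mul_assoc, one_mul, smul_smul]
    rfl
  · rw [JM, Finset.sum_mul]
    refine Finset.sum_congr rfl fun j hj => ?_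
    rw [Uk, Finset.mul_sum]
    refine Finset.sum_congr rfl fun π hπ => ?_
    rw [Finset.mem_Iio] at hj
    rw [mem_lowS] at hπ
    rw [numCycles_swap_mul π j k (hπ k le_rfl) hj.ne, mul_smul_comm]
    rw [dl, map_mul]

theorem JM_comm {n : ℕ} (k : Fin n) (π : Perm (Fin n)) (h : π ∈ lowS n k.val) :
    JM k * dl π = dl π * JM k := by
  rw [mem_lowS] at h
  have hk := h k le_rfl
  rw [JM, Finset.sum_mul, Finset.mul_sum]
  have hlt : ∀ j, j < k → π j < k := by
    intro j hj
    by_contra hc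
    rw [not_lt, Fin.le_def] at hc
    have := π.injective (h _ hc)
    rw [this, Fin.le_def.symm] at hc
    exact absurd hj (not_lt.2 hc)
  have hlt2 : ∀ j, j < k → π⁻¹ j < k := by
    intro j hj
    by_contra hc
    rw [not_lt, Fin.le_def] at hc
    have := h _ hc
    rw [show π (π⁻¹ j) = j by simp] at this
    rw [← this, Fin.le_def.symm] at hc
    exact absurd hj (not_lt.2 hc)
  symm
  apply Finset.sum_bij' (fun j _ => π j) (fun j _ => π⁻¹ j)
  · intro j hj; rw [Finset.mem_Iio] at hj ⊢; exact hlt j hj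
  · intro j hj; rw [Finset.mem_Iio] at hj ⊢; exact hlt2 j hj
  · simp
  · simp
  · intro j hj
    rw [dl, dl, dl, ← map_mul, ← map_mul]
    congr 1
    rw [Equiv.mul_swap_eq_swap_mul, hk]

/-- A Young tableau in row-reading order. -/
structure Tab (n : ℕ) where
  row : Fin n → ℕ
  col : Fin n → ℕ
  mono : Monotone row
  hcol : ∀ k, ((Finset.Iio k).filter fun j => row j = row k).card = col k
  hup : ∀ k r, r < row k → ∃ j, row j = r ∧ col j = col k
  inj : ∀ i j, row i = row j → col i = col j → i = j

namespace Tab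
variable {n : ℕ} (T : Tab n)

def R : Finset (Perm (Fin n)) := Finset.univ.filter fun p => ∀ i, T.row (p i) = T.row i
def C : Finset (Perm (Fin n)) := Finset.univ.filter fun p => ∀ i, T.col (p i) = T.col i

theorem mem_R {p : Perm (Fin n)} : p ∈ T.R ↔ ∀ i, T.row (p i) = T.row i := by simp [R]
theorem mem_C {p : Perm (Fin n)} : p ∈ T.C ↔ ∀ i, T.col (p i) = T.col i := by simp [C]

noncomputable def a : GA n := ∑ p ∈ T.R, dl p
noncomputable def b : GA n := ∑ q ∈ T.C, ((Perm.sign q : ℤ) : ℝ) • dl q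

theorem dl_mul_a (p : Perm (Fin n)) (hp : p ∈ T.R) : dl p * T.a = T.a := by
  rw [mem_R] at hp
  rw [a, Finset.mul_sum]
  apply Finset.sum_bij' (fun q _ => p * q) (fun q _ => p⁻¹ * q)
  · intro q hq; rw [mem_R] at hq ⊢; intro i; rw [Perm.mul_apply, hp, hq]
  · intro q hq; rw [mem_R] at hq ⊢; intro i
    rw [Perm.mul_apply, ← hp, ← hq i]; simp
  · simp
  · simp
  · intro q hq; rw [dl, dl, ← map_mul]

theorem b_mul_dl (j k : Fin n) (hjk : j ≠ k) (h : T.col j = T.col k) :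
    T.b * dl (swap j k) = - T.b := by
  have hs : ∀ i, T.col (swap j k i) = T.col i := by
    intro i
    by_cases h1 : i = j
    · subst h1; simp [h]
    · by_cases h2 : i = k
      · subst h2; simp [h]
      · rw [swap_apply_of_ne_of_ne h1 h2]
  rw [b, Finset.sum_mul, ← Finset.sum_neg_distrib]
  apply Finset.sum_bij' (fun q _ => q * swap j k) (fun q _ => q * swap j k)
  · intro q hq; rw [mem_C] at hq ⊢; intro i; rw [Perm.mul_apply, hq, hs]
  · intro q hq; rw [mem_C] at hq ⊢; intro i; rw [Perm.mul_apply, hq, hs]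
  · intro q _; simp [mul_assoc]
  · intro q _; simp [mul_assoc]
  · intro q hq
    rw [dl, dl, smul_mul_assoc, ← map_mul, Perm.sign_mul, Perm.sign_swap hjk]
    simp

theorem swap_mem_R (j k : Fin n) (h : T.row j = T.row k) : swap j k ∈ T.R := by
  rw [mem_R]
  intro i
  by_cases h1 : i = j
  · subst h1; simp [h]
  · by_cases h2 : i = k
    · subst h2; simp [h]
    · rw [swap_apply_of_ne_of_ne h1 h2]

theorem garnir (k : Fin n) (r : ℕ) (hr : r < T.row k) (D : GA n)
    (hD : ∀ π ∈ lowS n (k.val + 1), D * dl π = dl π * D) :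
    T.b * D * (∑ j ∈ Finset.univ.filter (fun j => T.row j = r), dl (swap j k)) * T.a =
      - (T.b * D * T.a) := by
  obtain ⟨j0, hj0, hc0⟩ := T.hup k r hr
  have hne : j0 ≠ k := by rintro rfl; omega
  have hlt : j0 < k := by
    by_contra hc
    have := T.mono (not_lt.1 hc); omega
  set s := Finset.univ.filter (fun j => T.row j = r) with hs
  set Y : GA n := 1 + ∑ j ∈ s, dl (swap j k) with hY
  have hj0s : j0 ∈ s := by simp [hs, hj0]
  have hYa : Y * T.a = T.a + dl (swap j0 k) * T.a + ∑ j ∈ s.erase j0, dl (swap j k) * T.a := by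
    rw [hY, add_mul, one_mul, ← Finset.add_sum_erase _ _ hj0s, add_mul, Finset.sum_mul, add_assoc]
  have hsq : dl (swap j0 k) * dl (swap j0 k) = (1 : GA n) := by
    rw [dl, ← map_mul, swap_mul_self, map_one]
  have htY : dl (swap j0 k) * (Y * T.a) = Y * T.a := by
    rw [hYa, mul_add, mul_add, ← mul_assoc, hsq, one_mul, Finset.mul_sum,
      add_comm (dl (swap j0 k) * T.a)]
    congr 1
    refine Finset.sum_congr rfl fun j hj => ?_
    rw [Finset.mem_erase, hs, Finset.mem_filter] at hj
    have hjk : j ≠ k := by rintro rfl; omega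
    have e : swap j0 k * swap j k = swap j k * swap j0 j := by
      rw [Equiv.mul_swap_eq_swap_mul (swap j k), swap_apply_of_ne_of_ne hj.1.symm hne,
        swap_apply_left]
    rw [← mul_assoc, dl, dl, ← map_mul, e, map_mul, mul_assoc]
    congr 1
    exact T.dl_mul_a _ (T.swap_mem_R _ _ (by omega))
  have htl : swap j0 k ∈ lowS n (k.val + 1) := by
    rw [mem_lowS]
    intro i hi
    rw [Fin.lt_def] at hlt
    apply swap_apply_of_ne_of_ne <;> · rintro rfl; omega
  have h0 : T.b * D * (Y * T.a) = - (T.b * D * (Y * T.a)) := by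
    conv_lhs => rw [← htY, ← mul_assoc, mul_assoc T.b, hD _ htl, ← mul_assoc T.b,
      T.b_mul_dl j0 k hne hc0]
    simp
  have h1 : T.b * D * (Y * T.a) = 0 := by
    have h2 : (2 : ℝ) • (T.b * D * (Y * T.a)) = 0 := by
      rw [two_smul]; nth_rewrite 2 [h0]; simp
    exact (smul_eq_zero.1 h2).resolve_left two_ne_zero
  rw [hY, add_mul, one_mul, mul_add] at h1
  rw [mul_assoc]
  exact eq_neg_of_add_eq_zero_right h1

theorem JM_step (k : Fin n) (D : GA n)
    (hD : ∀ π ∈ lowS n (k.val + 1), D * dl π = dl π * D) :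
    T.b * D * JM k * T.a = ((T.col k : ℝ) - (T.row k : ℝ)) • (T.b * D * T.a) := by
  have hsplit : JM k = ∑ j ∈ (Finset.Iio k).filter (fun j => T.row j = T.row k), dl (swap j k) +
      ∑ r ∈ Finset.range (T.row k), ∑ j ∈ Finset.univ.filter (fun j => T.row j = r),
        dl (swap j k) := by
    rw [JM, ← Finset.sum_filter_add_sum_filter_not _ (fun j => T.row j = T.row k)]
    congr 1
    rw [← Finset.sum_fiberwise_of_maps_to (t := Finset.range (T.row k)) (g := T.row)]
    · refine Finset.sum_congr rfl fun r hr => ?_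
      refine Finset.sum_congr ?_ fun _ _ => rfl
      rw [Finset.mem_range] at hr
      ext j
      simp only [Finset.mem_filter, Finset.mem_Iio, Finset.mem_univ, true_and]
      constructor
      · rintro ⟨_, h⟩; exact h
      · intro h
        refine ⟨⟨?_, by omega⟩, h⟩
        by_contra hc
        have := T.mono (not_lt.1 hc); omega
    · intro j hj
      simp only [Finset.mem_filter, Finset.mem_Iio] at hj
      rw [Finset.mem_range]
      exact lt_of_le_of_ne (T.mono hj.1.le) hj.2
  rw [hsplit, mul_add, add_mul, sub_smul, sub_eq_add_neg]
  congr 1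
  · rw [Finset.mul_sum, Finset.sum_mul]
    rw [Finset.sum_congr rfl (g := fun _ => T.b * D * T.a)]
    · rw [Finset.sum_const, T.hcol, Nat.cast_smul_eq_nsmul]
    · intro j hj
      rw [Finset.mem_filter] at hj
      rw [mul_assoc, T.dl_mul_a _ (T.swap_mem_R _ _ hj.2)]
  · rw [Finset.mul_sum, Finset.sum_mul]
    rw [Finset.sum_congr rfl (g := fun _ => - (T.b * D * T.a))]
    · rw [Finset.sum_const, Finset.card_range, Nat.cast_smul_eq_nsmul, smul_neg]
    · intro r hr
      rw [Finset.mem_range] at hr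
      exact T.garnir k r hr D hD

theorem exists_D (x : ℝ) (i : ℕ) (hi : i ≤ n) : ∃ D : GA n,
    D * Uk n (n - i) x = x ^ i • Phi n x ∧
    (∀ π ∈ lowS n (n - i), D * dl π = dl π * D) ∧
    T.b * D * T.a = (∏ k ∈ Finset.univ.filter (fun k : Fin n => n - i ≤ k.val),
      (x + ((T.col k : ℝ) - (T.row k : ℝ)))) • (T.b * T.a) := by
  induction i with
  | zero =>
    refine ⟨1, ?_, ?_, ?_⟩
    · simp [Uk_top]
    · simp
    · rw [Finset.prod_eq_one]
      · simp
      · intro k hk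
        have := k.isLt
        simp at hk; omega
  | succ i ih =>
    obtain ⟨D, h1, h2, h3⟩ := ih (by omega)
    let k : Fin n := ⟨n - (i + 1), by omega⟩
    have hk : n - i = k.val + 1 := by simp only [k]; omega
    rw [hk] at h1 h2 h3
    refine ⟨D * (x • 1 + JM k), ?_, ?_, ?_⟩
    · show D * (x • 1 + JM k) * Uk n k.val x = _
      rw [mul_assoc, ← Uk_succ, mul_smul_comm, h1, smul_smul, pow_succ']
    · intro π hπ
      have hπ' : π ∈ lowS n k.val := hπ
      have hπ2 : π ∈ lowS n (k.val + 1) := by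
        rw [mem_lowS] at hπ' ⊢
        intro j hj; exact hπ' j (by omega)
      rw [mul_assoc, add_mul, JM_comm k π hπ', smul_mul_assoc, one_mul, ← mul_assoc, ← h2 π hπ2,
        mul_assoc, mul_add, mul_add, mul_smul_comm, mul_smul_comm, mul_one, mul_add, mul_smul_comm]
    · have : (Finset.univ.filter fun j : Fin n => n - (i + 1) ≤ j.val) =
          insert k (Finset.univ.filter fun j : Fin n => k.val + 1 ≤ j.val) := by
        ext j
        simp only [Finset.mem_filter, Finset.mem_univ, true_and, Finset.mem_insert, Fin.ext_iff, k]
        omega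
      rw [this, Finset.prod_insert (by simp), mul_smul, ← h3, ← mul_assoc, mul_add, add_mul,
        T.JM_step k D h2, add_smul, mul_smul_comm, mul_one, smul_mul_assoc]

noncomputable def ev (x : ℝ) : ℝ := ∏ k : Fin n, (x + ((T.col k : ℝ) - (T.row k : ℝ)))

theorem b_Phi_a (x : ℝ) (hx : x ≠ 0) : T.b * Phi n x * T.a = T.ev x • (T.b * T.a) := by
  obtain ⟨D, h1, h2, h3⟩ := T.exists_D x n le_rfl
  have hD : D = Phi n x := by
    rw [Nat.sub_self, Uk_zero, mul_smul_comm, mul_one] at h1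
    exact smul_right_injective _ (pow_ne_zero n hx) h1
  rw [hD] at h3
  rw [h3, ev]
  simp

end Tab
end

section
open Equiv

variable {n : ℕ}

theorem coeff_dl_mul (g h : Perm (Fin n)) (x : GA n) : (dl g * x).coeff h = x.coeff (g⁻¹ * h) := by
  rw [dl, MonoidAlgebra.of_apply, MonoidAlgebra.coeff_single_mul_apply, one_mul]

theorem coeff_mul_dl (g h : Perm (Fin n)) (x : GA n) : (x * dl g).coeff h = x.coeff (h * g⁻¹) := by
  rw [dl, MonoidAlgebra.of_apply, MonoidAlgebra.coeff_mul_single_apply, mul_one]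

theorem coeff_dl (g h : Perm (Fin n)) : (dl g).coeff h = if g = h then 1 else 0 := by
  rw [dl, MonoidAlgebra.of_apply, MonoidAlgebra.coeff_single, Finsupp.single_apply]

theorem coeff_sum' {ι : Type*} (s : Finset ι) (f : ι → GA n) (h : Perm (Fin n)) :
    (∑ i ∈ s, f i).coeff h = ∑ i ∈ s, (f i).coeff h := by
  rw [MonoidAlgebra.coeff_sum, Finsupp.finsetSum_apply]

theorem coeff_Phi (x : ℝ) (h : Perm (Fin n)) : (Phi n x).coeff h = x ^ numCycles h := by
  rw [Phi, coeff_sum', Finset.sum_eq_single h]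
  · rw [MonoidAlgebra.coeff_smul_apply, coeff_dl]; simp
  · intro b _ hb
    rw [MonoidAlgebra.coeff_smul_apply, coeff_dl]; simp [hb]
  · simp

/-- The centre of the group algebra. -/
def Zc (n : ℕ) : Submodule ℝ (GA n) where
  carrier := {a | ∀ g, dl g * a = a * dl g}
  add_mem' := by
    intro a b ha hb g
    rw [mul_add, add_mul, ha g, hb g]
  zero_mem' := by intro g; simp
  smul_mem' := by
    intro c a ha g
    rw [mul_smul_comm, smul_mul_assoc, ha g]

theorem mem_Zc {a : GA n} : a ∈ Zc n ↔ ∀ g, dl g * a = a * dl g := Iff.rfl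

theorem Zc_comm {a : GA n} (ha : a ∈ Zc n) (b : GA n) : b * a = a * b := by
  induction b using MonoidAlgebra.induction_linear with
  | zero => simp
  | add f g hf hg => rw [add_mul, mul_add, hf, hg]
  | single m r =>
    have := ha m
    rw [← MonoidAlgebra.smul_of, smul_mul_assoc, mul_smul_comm]
    exact congrArg _ this

theorem Zc_coeff {a : GA n} (ha : a ∈ Zc n) (g h : Perm (Fin n)) :
    a.coeff (g * h * g⁻¹) = a.coeff h := by
  have := congrArg (fun y => y.coeff (g * h)) (ha g)
  simp only [coeff_dl_mul, coeff_mul_dl] at this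
  rw [← this]; simp

theorem Phi_mem (x : ℝ) : Phi n x ∈ Zc n := by
  intro g
  apply MonoidAlgebra.coeff_injective
  ext h
  rw [coeff_dl_mul, coeff_mul_dl, coeff_Phi, coeff_Phi]
  rw [← numCycles_conj g]
  congr 2
  group

/-- unnormalised averaging over conjugation -/
noncomputable def avg (n : ℕ) : GA n →ₗ[ℝ] GA n :=
  ∑ g : Perm (Fin n), (LinearMap.mulLeft ℝ (dl g)).comp (LinearMap.mulRight ℝ (dl g⁻¹))

theorem avg_apply (a : GA n) : avg n a = ∑ g : Perm (Fin n), dl g * a * dl g⁻¹ := by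
  simp [avg, LinearMap.sum_apply, mul_assoc]

theorem avg_mem (a : GA n) : avg n a ∈ Zc n := by
  intro h
  rw [avg_apply, Finset.mul_sum, Finset.sum_mul]
  apply Finset.sum_bij' (fun g _ => h * g) (fun g _ => h⁻¹ * g)
  · simp
  · simp
  · simp
  · simp
  · intro g _
    have e : dl (h * g)⁻¹ * dl h = (dl g⁻¹ : GA n) := by
      rw [dl, dl, ← map_mul]; simp
    rw [mul_assoc (dl (h * g) * a), e]
    simp only [dl, map_mul, mul_assoc]

theorem avg_of_mem {a : GA n} (ha : a ∈ Zc n) : avg n a = (n.factorial : ℝ) • a := by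
  rw [avg_apply]
  rw [Finset.sum_congr rfl (g := fun _ => a)]
  · rw [Finset.sum_const, Finset.card_univ, Fintype.card_perm, Fintype.card_fin,
      Nat.cast_smul_eq_nsmul]
  · intro g _
    rw [ha g, mul_assoc, dl, dl, ← map_mul, mul_inv_cancel, map_one, mul_one]

noncomputable def Tphi (n : ℕ) (x : ℝ) : GA n →ₗ[ℝ] GA n :=
  (LinearMap.mulLeft ℝ (Phi n x)).comp (avg n)

theorem Tphi_apply (x : ℝ) (a : GA n) : Tphi n x a = Phi n x * avg n a := rfl

theorem Tphi_mem (x : ℝ) (a : GA n) : Tphi n x a ∈ Zc n := by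
  intro g
  rw [Tphi_apply, ← mul_assoc, Phi_mem x g, mul_assoc, avg_mem a g, mul_assoc]

theorem trace_Top (x : ℝ) : LinearMap.trace ℝ (GA n) (Tphi n x) =
    ∑ p : Perm (Fin n) × Perm (Fin n), x ^ numCycles (p.1 * p.2 * p.1⁻¹ * p.2⁻¹) := by
  rw [LinearMap.trace_eq_matrix_trace ℝ (MonoidAlgebra.basis (Perm (Fin n)) ℝ),
    Fintype.sum_prod_type]
  refine Finset.sum_congr rfl fun σ _ => ?_
  rw [Matrix.diag_apply, LinearMap.toMatrix_apply, MonoidAlgebra.basis_apply]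
  show (Tphi n x (dl σ)).coeff σ = _
  rw [Tphi_apply, avg_apply, Finset.mul_sum, coeff_sum']
  refine Finset.sum_congr rfl fun g _ => ?_
  rw [← mul_assoc, ← mul_assoc, coeff_mul_dl, coeff_mul_dl, coeff_mul_dl, coeff_Phi]
  simp [mul_assoc]

theorem finrank_Zc_le : Module.finrank ℝ (Zc n) ≤ Fintype.card (Nat.Partition n) := by
  classical
  have e : Fintype.card (Nat.Partition n) = Fintype.card (Nat.Partition (Fintype.card (Fin n))) := by
    rw [Fintype.card_fin]
  rw [e, ← Module.finrank_fintype_fun_eq_card (η := Nat.Partition (Fintype.card (Fin n))) ℝ]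
  let L : (Zc n) →ₗ[ℝ] (Nat.Partition (Fintype.card (Fin n)) → ℝ) :=
    { toFun := fun a p => if h : ∃ π : Perm (Fin n), π.partition = p then a.1.coeff h.choose else 0
      map_add' := by
        intro a b; ext p
        by_cases h : ∃ π : Perm (Fin n), π.partition = p <;> simp [h]
      map_smul' := by
        intro a b; ext p
        by_cases h : ∃ π : Perm (Fin n), π.partition = p <;> simp [h] }
  apply LinearMap.finrank_le_finrank_of_injective (f := L)
  intro a b hab
  apply Subtype.ext
  apply MonoidAlgebra.coeff_injective
  ext π
  have h : ∃ π' : Perm (Fin n), π'.partition = π.partition := ⟨π, rfl⟩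
  have h1 := congrFun hab π.partition
  simp only [L, LinearMap.coe_mk, AddHom.coe_mk, h, dite_true] at h1
  have h2 := h.choose_spec
  rw [← Perm.partition_eq_of_isConj, isConj_iff] at h2
  obtain ⟨c, hc⟩ := h2
  rw [← hc, Zc_coeff a.2, Zc_coeff b.2]
  exact h1

namespace Tab

noncomputable def z (T : Tab n) : GA n := avg n (T.b * T.a)

theorem coeff_ba (T : Tab n) : (T.b * T.a).coeff 1 = 1 := by
  rw [a, Finset.mul_sum, coeff_sum', Finset.sum_eq_single 1]
  · rw [coeff_mul_dl, b, coeff_sum', Finset.sum_eq_single 1]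
    · rw [MonoidAlgebra.coeff_smul_apply, coeff_dl]; simp
    · intro q _ hq
      rw [MonoidAlgebra.coeff_smul_apply, coeff_dl]; simp [hq]
    · intro h; exact absurd (T.mem_C.2 (by simp)) h
  · intro p hp hp1
    rw [coeff_mul_dl, b, coeff_sum']
    apply Finset.sum_eq_zero
    intro q hq
    rw [MonoidAlgebra.coeff_smul_apply, coeff_dl, if_neg, smul_zero]
    intro h
    rw [one_mul] at h
    rw [mem_R] at hp
    rw [mem_C, h] at hq
    apply hp1
    ext i
    rw [Perm.one_apply, T.inj (p i) i (hp i) (by rw [← hq (p i)]; simp)]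
  · intro h; exact absurd (T.mem_R.2 (by simp)) h

theorem z_ne (T : Tab n) : T.z ≠ 0 := by
  intro h
  have h1 : (T.z).coeff 1 = n.factorial := by
    rw [z, avg_apply, coeff_sum', Finset.sum_congr rfl (g := fun _ => (1:ℝ))]
    · rw [Finset.sum_const, Finset.card_univ, Fintype.card_perm, Fintype.card_fin]; simp
    · intro g _
      rw [coeff_mul_dl, coeff_dl_mul, ← T.coeff_ba]
      congr 1; group
  rw [h] at h1
  simp at h1
  exact absurd h1.symm (by exact_mod_cast Nat.factorial_ne_zero n)

theorem Tphi_z (T : Tab n) (x : ℝ) (hx : x ≠ 0) :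
    Tphi n x T.z = (n.factorial * T.ev x) • T.z := by
  have h1 : Phi n x * T.z = T.ev x • T.z := by
    have h2 : Phi n x * (T.b * T.a) = T.ev x • (T.b * T.a) := by
      rw [← T.b_Phi_a x hx, ← mul_assoc, ← Zc_comm (Phi_mem x) T.b]
    rw [z, ← map_smul, ← h2, avg_apply, avg_apply, Finset.mul_sum]
    refine Finset.sum_congr rfl fun g _ => ?_
    rw [← mul_assoc, ← mul_assoc, ← Phi_mem x g, mul_assoc (dl g)]
  rw [Tphi_apply, avg_of_mem (a := T.z) (avg_mem _), mul_smul_comm, h1, smul_smul]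

end Tab

theorem main_trace {ι : Type*} [Fintype ι] (T : ι → Tab n)
    (hcard : Fintype.card (Nat.Partition n) ≤ Fintype.card ι)
    (hx : ∃ x : ℝ, x ≠ 0 ∧ Function.Injective fun i => (T i).ev x) (x : ℝ) (hx0 : x ≠ 0) :
    ∑ p : Perm (Fin n) × Perm (Fin n), x ^ numCycles (p.1 * p.2 * p.1⁻¹ * p.2⁻¹) =
      n.factorial * ∑ i, (T i).ev x := by
  classical
  obtain ⟨y, hy0, hy⟩ := hx
  have hnf : (n.factorial : ℝ) ≠ 0 := by exact_mod_cast Nat.factorial_ne_zero n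
  let v : ι → Zc n := fun i => ⟨(T i).z, avg_mem _⟩
  have hfin : FiniteDimensional ℝ (GA n) :=
    Module.Finite.of_basis (MonoidAlgebra.basis (Perm (Fin n)) ℝ)
  let f : ℝ → (Zc n →ₗ[ℝ] Zc n) := fun x => (Tphi n x).restrict (fun a _ => Tphi_mem x a)
  have hf : ∀ x, x ≠ 0 → ∀ i, f x (v i) = (n.factorial * (T i).ev x) • v i := by
    intro x hx i
    apply Subtype.ext
    exact (T i).Tphi_z x hx
  have hli : LinearIndependent ℝ v := by
    refine Module.End.eigenvectors_linearIndependent' (f y) (fun i => n.factorial * (T i).ev y)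
      ?_ v ?_
    · intro i j hij
      exact hy (mul_left_cancel₀ hnf hij)
    · intro i
      rw [Module.End.hasEigenvector_iff, Module.End.mem_eigenspace_iff]
      refine ⟨hf y hy0 i, ?_⟩
      intro h
      exact (T i).z_ne (congrArg Subtype.val h)
  have hc : Fintype.card ι = Module.finrank ℝ (Zc n) :=
    le_antisymm hli.fintype_card_le_finrank (finrank_Zc_le.trans hcard)
  let B := basisOfLinearIndependentOfCardEqFinrank' v hli hc
  have hB : ∀ i, B i = v i := fun i => by
    simp only [B, coe_basisOfLinearIndependentOfCardEqFinrank']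
  rw [← trace_Top, ← LinearMap.trace_restrict_eq_of_forall_mem (Zc n) (Tphi n x) (Tphi_mem x),
    LinearMap.trace_eq_matrix_trace ℝ B, Matrix.trace, Finset.mul_sum]
  refine Finset.sum_congr rfl fun i _ => ?_
  rw [Matrix.diag_apply, LinearMap.toMatrix_apply]
  have : (Tphi n x).restrict (fun a _ => Tphi_mem x a) (B i) = (n.factorial * (T i).ev x) • B i := by
    rw [hB]; exact hf x hx0 i
  rw [this]
  simp
end

section
open Equiv

/-- Young diagrams with `n` cells. -/
abbrev YD (n : ℕ) := {μ : YoungDiagram // μ.cells.card = n}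

theorem mem_lt_card (μ : YoungDiagram) (i j : ℕ) (h : (i, j) ∈ μ) :
    i < μ.cells.card ∧ j < μ.cells.card := by
  constructor
  · have : (Finset.range (i + 1)).card ≤ μ.cells.card := by
      apply Finset.card_le_card_of_injOn (fun t => (t, j))
      · intro t ht
        simp at ht ⊢
        exact μ.up_left_mem (by omega) le_rfl h
      · intro a _ b _ h; simpa using h
    simpa using this
  · have : (Finset.range (j + 1)).card ≤ μ.cells.card := by
      apply Finset.card_le_card_of_injOn (fun t => (i, t))
      · intro t ht
        simp at ht ⊢
        exact μ.up_left_mem le_rfl (by omega) h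
      · intro a _ b _ h; simpa using h
    simpa using this

instance (n : ℕ) : Finite (YD n) := by
  apply Finite.of_injective (β := {s // s ∈ (Finset.range n ×ˢ Finset.range n).powerset})
    (fun μ => ⟨μ.1.cells, by
      rw [Finset.mem_powerset]
      rintro ⟨i, j⟩ h
      have := mem_lt_card μ.1 i j h
      rw [μ.2] at this
      simpa using this⟩)
  intro a b h
  simp at h
  exact Subtype.ext (YoungDiagram.ext h)

noncomputable instance (n : ℕ) : Fintype (YD n) := Fintype.ofFinite _

theorem card_cellsOfRowLens (w : List ℕ) : (YoungDiagram.cellsOfRowLens w).card = w.sum := by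
  induction w with
  | nil => rfl
  | cons a w ih =>
    rw [YoungDiagram.cellsOfRowLens, Finset.card_union_of_disjoint, Finset.card_map, ih]
    · simp
    · rw [Finset.disjoint_left]
      rintro ⟨i, j⟩ h1 h2
      simp at h1 h2
      obtain ⟨a, b, _, h, _⟩ := h2
      omega

theorem card_partition_le (n : ℕ) : Fintype.card (Nat.Partition n) ≤ Fintype.card (YD n) := by
  have hs : ∀ p : Nat.Partition n, (p.parts.sort (· ≥ ·)).SortedGE := fun p =>
    (Multiset.pairwise_sort _ _).sortedGE
  have hpos : ∀ p : Nat.Partition n, ∀ x ∈ p.parts.sort (· ≥ ·), 0 < x := fun p x hx =>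
    p.parts_pos (by simpa using hx)
  apply Fintype.card_le_of_injective (fun p => (⟨YoungDiagram.ofRowLens _ (hs p), by
    show (YoungDiagram.cellsOfRowLens _).card = n
    rw [card_cellsOfRowLens, ← Multiset.sum_coe, Multiset.sort_eq, p.parts_sum]⟩ : YD n))
  intro p q h
  have h := congrArg (fun y : YD n => y.1.rowLens) h
  simp only [YoungDiagram.rowLens_ofRowLens_eq_self (hpos p),
    YoungDiagram.rowLens_ofRowLens_eq_self (hpos q)] at h
  have h := congrArg (fun l : List ℕ => (l : Multiset ℕ)) h
  simp only [Multiset.sort_eq] at h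
  exact Nat.Partition.ext h

def lexCells (μ : YoungDiagram) : Finset (ℕ ×ₗ ℕ) := μ.cells.map toLex.toEmbedding

theorem mem_lexCells (μ : YoungDiagram) (i j : ℕ) : toLex (i, j) ∈ lexCells μ ↔ (i, j) ∈ μ := by
  simp [lexCells]

noncomputable def rd {n : ℕ} (μ : YD n) : Fin n ↪o ℕ ×ₗ ℕ :=
  (lexCells μ.1).orderEmbOfFin (by rw [lexCells, Finset.card_map, μ.2])

theorem rd_mem {n : ℕ} (μ : YD n) (k : Fin n) : ((ofLex (rd μ k)).1, (ofLex (rd μ k)).2) ∈ μ.1 := by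
  rw [← mem_lexCells]
  exact Finset.orderEmbOfFin_mem (lexCells μ.1) (by rw [lexCells, Finset.card_map, μ.2]) k

theorem rd_surj {n : ℕ} (μ : YD n) (i j : ℕ) (h : (i, j) ∈ μ.1) : ∃ k, rd μ k = toLex (i, j) := by
  rw [← mem_lexCells] at h
  have := Finset.range_orderEmbOfFin (lexCells μ.1) (k := n) (by rw [lexCells, Finset.card_map, μ.2])
  have h2 : toLex (i, j) ∈ (↑(lexCells μ.1) : Set _) := h
  rw [← this] at h2
  exact h2

noncomputable def tabOf {n : ℕ} (μ : YD n) : Tab n where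
  row k := (ofLex (rd μ k)).1
  col k := (ofLex (rd μ k)).2
  mono := fun a b h => Prod.Lex.monotone_fst _ _ ((rd μ).monotone h)
  hcol := by
    intro k
    conv_rhs => rw [← Finset.card_range (ofLex (rd μ k)).2]
    apply Finset.card_nbij (fun j => (ofLex (rd μ j)).2)
    · intro j hj
      simp only [Finset.coe_filter, Finset.mem_Iio, Set.mem_ofPred_eq] at hj
      have := (rd μ).strictMono hj.1
      rw [Prod.Lex.lt_iff] at this
      simp
      omega
    · intro a ha b hb hab
      simp only [Finset.coe_filter, Finset.mem_Iio, Set.mem_ofPred_eq] at ha hb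
      apply (rd μ).injective
      apply ofLex.injective
      exact Prod.ext (ha.2.trans hb.2.symm) hab
    · intro c hc
      simp at hc
      obtain ⟨j, hj⟩ := rd_surj μ (ofLex (rd μ k)).1 c (μ.1.up_left_mem le_rfl hc.le (rd_mem μ k))
      refine ⟨j, ?_, ?_⟩
      · simp only [Finset.coe_filter, Finset.mem_Iio, Set.mem_ofPred_eq, hj]
        refine ⟨?_, rfl⟩
        rw [← (rd μ).lt_iff_lt, hj, Prod.Lex.lt_iff]
        right
        exact ⟨rfl, hc⟩
      · simp [hj]
  hup := by
    intro k r hr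
    obtain ⟨j, hj⟩ := rd_surj μ r (ofLex (rd μ k)).2 (μ.1.up_left_mem hr.le le_rfl (rd_mem μ k))
    exact ⟨j, by simp [hj], by simp [hj]⟩
  inj := by
    intro i j h1 h2
    apply (rd μ).injective
    apply ofLex.injective
    exact Prod.ext h1 h2

open Polynomial in
/-- content polynomial -/
noncomputable def cp (μ : YoungDiagram) : ℝ[X] := ∏ c ∈ μ.cells, (X - C ((c.1 : ℝ) - (c.2 : ℝ)))

theorem ev_tabOf {n : ℕ} (μ : YD n) (x : ℝ) : (tabOf μ).ev x = (cp μ.1).eval x := by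
  rw [cp, Polynomial.eval_prod, Tab.ev]
  apply Finset.prod_bij (fun k _ => ofLex (rd μ k))
  · intro k _; exact rd_mem μ k
  · intro a _ b _ h; exact (rd μ).injective (ofLex.injective h)
  · rintro ⟨i, j⟩ h
    obtain ⟨k, hk⟩ := rd_surj μ i j h
    exact ⟨k, Finset.mem_univ _, by rw [hk]; rfl⟩
  · intro k _
    simp [tabOf]
    ring

theorem cp_roots (μ : YoungDiagram) :
    (cp μ).roots = μ.cells.val.map (fun c => (c.1 : ℝ) - (c.2 : ℝ)) := by
  rw [cp, Finset.prod]
  have := Polynomial.roots_multiset_prod_X_sub_C (μ.cells.val.map (fun c => (c.1 : ℝ) - (c.2 : ℝ)))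
  rw [Multiset.map_map] at this
  exact this

theorem cp_count (μ : YoungDiagram) (d : ℝ) : (cp μ).roots.count d =
    (μ.cells.filter fun c => (c.1 : ℝ) - (c.2 : ℝ) = d).card := by
  rw [cp_roots, Multiset.count_map, Finset.card_def, Finset.filter_val]
  congr 1
  apply Multiset.filter_congr
  intro c _
  exact eq_comm

theorem mem_iff_count (μ : YoungDiagram) (i j : ℕ) :
    (i, j) ∈ μ ↔ min i j < (cp μ).roots.count ((i : ℝ) - (j : ℝ)) := by
  rw [cp_count]
  have hc : ∀ c : ℕ × ℕ, ((c.1 : ℝ) - (c.2 : ℝ) = (i : ℝ) - (j : ℝ)) ↔ c.1 + j = i + c.2 := by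
    intro c
    rw [sub_eq_sub_iff_add_eq_add]
    norm_cast
  simp only [hc]
  constructor
  · intro h
    have : (Finset.range (min i j + 1)).card ≤
        (μ.cells.filter fun c => c.1 + j = i + c.2).card := by
      apply Finset.card_le_card_of_injOn (fun t => (i - t, j - t))
      · intro t ht
        simp at ht
        simp
        refine ⟨μ.up_left_mem (by omega) (by omega) h, by omega⟩
      · intro a ha b hb hab
        simp at ha hb hab
        omega
    simpa using this
  · intro h
    by_contra hn
    apply absurd h
    rw [not_lt]
    have : (μ.cells.filter fun c => c.1 + j = i + c.2).card ≤ (Finset.range (min i j)).card := by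
      apply Finset.card_le_card_of_injOn (fun c => min c.1 c.2)
      · rintro ⟨a, b⟩ ht
        simp at ht
        by_contra hlt
        simp at hlt
        apply hn
        refine μ.up_left_mem ?_ ?_ ht.1 <;> omega
      · rintro ⟨a, b⟩ ha ⟨c, d⟩ hb hab
        simp at ha hb hab
        ext <;> simp <;> omega
    simpa using this

theorem cp_injective : Function.Injective cp := by
  intro μ ν h
  apply YoungDiagram.ext
  ext ⟨i, j⟩
  rw [YoungDiagram.mem_cells, YoungDiagram.mem_cells, mem_iff_count, mem_iff_count, h]

theorem exists_sep (n : ℕ) : ∃ x : ℝ, x ≠ 0 ∧ Function.Injective fun μ : YD n => (tabOf μ).ev x := by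
  classical
  let Q : Polynomial ℝ := Polynomial.X * ∏ p ∈ (Finset.univ : Finset (YD n × YD n)).filter
    (fun p => p.1 ≠ p.2), (cp p.1.1 - cp p.2.1)
  have hQ : Q ≠ 0 := by
    apply mul_ne_zero Polynomial.X_ne_zero
    rw [Finset.prod_ne_zero_iff]
    intro p hp
    simp only [Finset.mem_filter, Finset.mem_univ, true_and] at hp
    intro h
    exact hp (Subtype.ext (cp_injective (sub_eq_zero.1 h)))
  have : ∃ x, Q.eval x ≠ 0 := by
    by_contra hc
    push Not at hc
    exact hQ (Polynomial.funext (by simpa using hc))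
  obtain ⟨x, hx⟩ := this
  rw [Polynomial.eval_mul, Polynomial.eval_prod] at hx
  refine ⟨x, fun h => hx (by simp [h]), ?_⟩
  intro μ ν h
  by_contra hne
  simp only [ev_tabOf] at h
  apply hx
  rw [Finset.prod_eq_zero (i := (μ, ν)), mul_zero]
  · simpa using hne
  · simp [h]

/-- The polynomial identity. -/
theorem main_poly (n : ℕ) :
    ∑ p : Perm (Fin n) × Perm (Fin n),
      (Polynomial.X : Polynomial ℝ) ^ numCycles (p.1 * p.2 * p.1⁻¹ * p.2⁻¹) =
      Polynomial.C (n.factorial : ℝ) * ∑ μ : YD n, cp μ.1 := by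
  apply Polynomial.eq_of_infinite_eval_eq
  apply Set.Infinite.mono (s := {x : ℝ | x ≠ 0})
  · intro x hx
    have := main_trace (fun μ : YD n => tabOf μ) (card_partition_le n) (exists_sep n) x hx
    simp only [ev_tabOf] at this
    simp only [Set.mem_ofPred_eq, Polynomial.eval_finsetSum, Polynomial.eval_mul,
      Polynomial.eval_C, Polynomial.eval_pow, Polynomial.eval_X]
    exact this
  · exact (Set.finite_singleton (0:ℝ)).infinite_compl
end

section
open Equiv

theorem fact_mul_le (i j : ℕ) : (i+1).factorial * (j+1).factorial ≤ (i+j+1).factorial := by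
  induction j with
  | zero => simp
  | succ j ih =>
    rw [Nat.factorial_succ (j+1), show i + (j+1) + 1 = (i + j + 1) + 1 by ring,
      Nat.factorial_succ (i+j+1)]
    calc (i+1).factorial * ((j+1+1) * (j+1).factorial)
        = (j+1+1) * ((i+1).factorial * (j+1).factorial) := by ring
      _ ≤ _ := Nat.mul_le_mul (by omega) ih

theorem sum_fact_le (N : ℕ) :
    ∑ p ∈ Finset.HasAntidiagonal.antidiagonal N, p.1.factorial * p.2.factorial ≤ 3 * N.factorial := by
  rw [Finset.Nat.sum_antidiagonal_eq_sum_range_succ (fun a b => a.factorial * b.factorial)]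
  rcases N with _ | N
  · simp
  rw [Finset.sum_range_succ, Finset.sum_range_succ']
  have : ∑ k ∈ Finset.range N, (k+1).factorial * (N + 1 - (k+1)).factorial
      ≤ ∑ k ∈ Finset.range N, N.factorial := by
    apply Finset.sum_le_sum
    intro k hk
    have hk := Finset.mem_range.1 hk
    have := fact_mul_le k (N - k - 1)
    rw [show N - k - 1 + 1 = N + 1 - (k+1) by omega, show k + (N-k-1) + 1 = N by omega] at this
    exact this
  simp only [Finset.sum_const, Finset.card_range, smul_eq_mul] at this
  have h2 : N * N.factorial ≤ (N+1).factorial := by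
    rw [Nat.factorial_succ]; exact Nat.mul_le_mul_right _ (by omega)
  simp only [Nat.factorial_zero, Nat.sub_zero, Nat.sub_self, one_mul, mul_one]
  omega

theorem sum_piAntidiag_le {ι : Type*} [DecidableEq ι] (s : Finset ι) (N : ℕ) :
    ∑ f ∈ Finset.piAntidiag s N, ∏ i ∈ s, (f i).factorial ≤ 3 ^ s.card * N.factorial := by
  induction s using Finset.induction_on generalizing N with
  | empty =>
    rw [Finset.piAntidiag_empty]
    split_ifs with h
    · simp [h]
    · simp
  | insert a s ha ih =>
    rw [← Finset.cons_eq_insert a s ha, Finset.piAntidiag_cons ha, Finset.sum_disjiUnion,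
      Finset.card_cons]
    calc _ ≤ ∑ p ∈ Finset.HasAntidiagonal.antidiagonal N, p.1.factorial * (3 ^ s.card * p.2.factorial) := by
            apply Finset.sum_le_sum
            rintro ⟨p, q⟩ hp
            rw [Finset.sum_map]
            calc _ = ∑ f ∈ Finset.piAntidiag s q, p.factorial * ∏ i ∈ s, (f i).factorial := by
                  apply Finset.sum_congr rfl
                  intro f hf
                  rw [Finset.mem_piAntidiag] at hf
                  have hfa : f a = 0 := by
                    by_contra h
                    exact ha (hf.2 a h)
                  rw [Finset.prod_cons]
                  congr 1
                  · simp [hfa]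
                  · apply Finset.prod_congr rfl
                    intro i hi
                    have : i ≠ a := fun h => ha (h ▸ hi)
                    simp [this]
              _ ≤ _ := by
                  rw [← Finset.mul_sum]
                  exact Nat.mul_le_mul_left _ (ih q)
        _ = 3 ^ s.card * ∑ p ∈ Finset.HasAntidiagonal.antidiagonal N, p.1.factorial * p.2.factorial := by
            rw [Finset.mul_sum]; apply Finset.sum_congr rfl; intros; ring
        _ ≤ 3 ^ s.card * (3 * N.factorial) := Nat.mul_le_mul_left _ (sum_fact_le N)
        _ = _ := by ring

noncomputable def mm (μ : YoungDiagram) : ℕ := (cp μ).roots.count 1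

theorem mem_mm (μ : YoungDiagram) (t : ℕ) : (t+1, t) ∈ μ ↔ t < mm μ := by
  rw [mem_iff_count, mm]
  simp

theorem mem_row (μ : YoungDiagram) (i l : ℕ) : (i, i + l) ∈ μ ↔ l < μ.rowLen i - i := by
  rw [YoungDiagram.mem_iff_lt_rowLen]; omega

theorem mem_col (μ : YoungDiagram) (j l : ℕ) : (j + 2 + l, j) ∈ μ ↔ l < μ.colLen j - j - 2 := by
  rw [YoungDiagram.mem_iff_lt_colLen]; omega

theorem row_zero (μ : YoungDiagram) (i : ℕ) (h : mm μ < i) : μ.rowLen i - i = 0 := by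
  by_contra hc
  have : (i, i) ∈ μ := (mem_row μ i 0).2 (by omega)
  obtain ⟨t, rfl⟩ : ∃ t, i = t + 1 := ⟨i - 1, by omega⟩
  have := (mem_mm μ t).1 (μ.up_left_mem le_rfl (by omega) this)
  omega

theorem col_zero (μ : YoungDiagram) (j : ℕ) (h : mm μ ≤ j) : μ.colLen j - j - 2 = 0 := by
  by_contra hc
  have : (j + 2, j) ∈ μ := (mem_col μ j 0).2 (by omega)
  have := (mem_mm μ j).1 (μ.up_left_mem (by omega) le_rfl this)
  omega

@[to_additive]
theorem prod_cells {M : Type*} [CommMonoid M] (μ : YoungDiagram) (f : ℕ × ℕ → M) :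
    ∏ c ∈ μ.cells, f c = (∏ t ∈ Finset.range (mm μ), f (t+1, t)) *
      ((∏ i ∈ Finset.range (mm μ + 1), ∏ l ∈ Finset.range (μ.rowLen i - i), f (i, i + l)) *
      ∏ j ∈ Finset.range (mm μ), ∏ l ∈ Finset.range (μ.colLen j - j - 2), f (j + 2 + l, j)) := by
  rw [← Finset.prod_filter_mul_prod_filter_not μ.cells (fun c => c.1 = c.2 + 1)]
  rw [← Finset.prod_filter_mul_prod_filter_not (μ.cells.filter (fun c => ¬ c.1 = c.2 + 1))
    (fun c => c.1 ≤ c.2)]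
  congr 1
  · symm
    apply Finset.prod_bij (fun t _ => (t + 1, t))
    · intro t ht
      simpa using (mem_mm μ t).2 (Finset.mem_range.1 ht)
    · intro a _ b _ h; simpa using h
    · rintro ⟨i, j⟩ h
      simp at h
      obtain ⟨h, rfl⟩ := h
      exact ⟨j, Finset.mem_range.2 ((mem_mm μ j).1 h), rfl⟩
    · intros; rfl
  congr 1
  · symm
    rw [Finset.prod_sigma']
    apply Finset.prod_bij (fun t _ => (t.1, t.1 + t.2))
    · rintro ⟨i, l⟩ ht
      simp at ht
      simp
      exact ⟨(mem_row μ i l).2 ht.2, by omega⟩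
    · rintro ⟨a, b⟩ _ ⟨c, d⟩ _ h; simp at h; obtain ⟨rfl, h⟩ := h; simpa using h
    · rintro ⟨i, j⟩ h
      simp at h
      obtain ⟨l, rfl⟩ : ∃ l, j = i + l := ⟨j - i, by omega⟩
      have := (mem_row μ i l).1 h.1.1
      refine ⟨⟨i, l⟩, ?_, rfl⟩
      simp
      refine ⟨?_, this⟩
      by_contra hc
      have := row_zero μ i (by omega)
      omega
    · intros; rfl
  · symm
    rw [Finset.prod_sigma']
    apply Finset.prod_bij (fun t _ => (t.1 + 2 + t.2, t.1))
    · rintro ⟨i, l⟩ ht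
      simp at ht
      simp
      exact ⟨⟨(mem_col μ i l).2 ht.2, by omega⟩, by omega⟩
    · rintro ⟨a, b⟩ _ ⟨c, d⟩ _ h; simp at h; obtain ⟨h, rfl⟩ := h; simp at h; simpa using h
    · rintro ⟨i, j⟩ h
      simp at h
      obtain ⟨l, rfl⟩ : ∃ l, i = j + 2 + l := ⟨i - j - 2, by omega⟩
      have := (mem_col μ j l).1 h.1.1
      refine ⟨⟨j, l⟩, ?_, rfl⟩
      simp
      refine ⟨?_, this⟩
      by_contra hc
      have := col_zero μ j (by omega)
      omega
    · intros; rfl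

/-- Frobenius-like coordinates -/
def gg (μ : YoungDiagram) : ℕ ⊕ ℕ → ℕ :=
  Sum.elim (fun i => μ.rowLen i - i) (fun j => μ.colLen j - j - 2)

theorem gg_inj (μ ν : YoungDiagram) (hm : mm μ = mm ν) (h : gg μ = gg ν) : μ = ν := by
  apply YoungDiagram.ext
  ext ⟨i, j⟩
  rw [YoungDiagram.mem_cells, YoungDiagram.mem_cells]
  rcases lt_trichotomy i (j + 1) with hij | rfl | hij
  · obtain ⟨l, rfl⟩ : ∃ l, j = i + l := ⟨j - i, by omega⟩
    have := congrFun h (Sum.inl i)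
    simp only [gg, Sum.elim_inl] at this
    rw [mem_row, mem_row, this]
  · rw [mem_mm, mem_mm, hm]
  · obtain ⟨l, rfl⟩ : ∃ l, i = j + 2 + l := ⟨i - j - 2, by omega⟩
    have := congrFun h (Sum.inr j)
    simp only [gg, Sum.elim_inr] at this
    rw [mem_col, mem_col, this]

def idx (m : ℕ) : Finset (ℕ ⊕ ℕ) := (Finset.range (m + 1)).disjSum (Finset.range m)

theorem card_idx (m : ℕ) : (idx m).card = 2 * m + 1 := by
  simp [idx, Finset.card_disjSum]; ring

/-- product of factorials -/
noncomputable def Pf (μ : YoungDiagram) : ℕ := ∏ x ∈ idx (mm μ), (gg μ x).factorial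

theorem sum_gg (μ : YoungDiagram) : mm μ + ∑ x ∈ idx (mm μ), gg μ x = μ.cells.card := by
  have := sum_cells μ (fun _ => 1)
  simp only [Finset.sum_const, Finset.card_range, smul_eq_mul, mul_one] at this
  rw [this, idx, Finset.sum_disjSum]
  rfl

theorem gg_mem {n : ℕ} (μ : YD n) : gg μ.1 ∈ Finset.piAntidiag (idx (mm μ.1)) (n - mm μ.1) := by
  rw [Finset.mem_piAntidiag]
  refine ⟨?_, ?_⟩
  · have := sum_gg μ.1
    rw [μ.2] at this
    exact Nat.eq_sub_of_add_eq (by rw [add_comm]; exact this)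
  · rintro (i | j) h
    · simp only [idx, Finset.inl_mem_disjSum, Finset.mem_range]
      by_contra hc
      exact h (row_zero _ _ (by omega))
    · simp only [idx, Finset.inr_mem_disjSum, Finset.mem_range]
      by_contra hc
      exact h (col_zero _ _ (by omega))

theorem sum_Pf_le (n m : ℕ) :
    ∑ μ : YD n with mm μ.1 = m, Pf μ.1 ≤ 3 ^ (2 * m + 1) * (n - m).factorial := by
  classical
  rw [← card_idx m]
  refine le_trans ?_ (sum_piAntidiag_le (idx m) (n - m))
  have h1 : ∑ μ : YD n with mm μ.1 = m, Pf μ.1 =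
      ∑ f ∈ (Finset.univ.filter (fun μ : YD n => mm μ.1 = m)).image (fun μ => gg μ.1),
        ∏ i ∈ idx m, (f i).factorial := by
    rw [Finset.sum_image]
    · apply Finset.sum_congr rfl
      intro μ hμ
      simp at hμ
      rw [Pf, hμ]
    · intro a ha b hb h
      simp at ha hb
      exact Subtype.ext (gg_inj _ _ (ha.trans hb.symm) h)
  rw [h1]
  apply Finset.sum_le_sum_of_subset
  intro f hf
  rw [Finset.mem_image] at hf
  obtain ⟨μ, hμ, rfl⟩ := hf
  simp at hμ
  have := gg_mem μ
  rwa [hμ] at this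
end

section
open Equiv

/-- real harmonic numbers -/
noncomputable def Hr (n : ℕ) : ℝ := ∑ i ∈ Finset.range n, 1 / ((i : ℝ) + 1)
noncomputable def Hr2 (n : ℕ) : ℝ := ∑ i ∈ Finset.range n, 1 / ((i : ℝ) + 1) ^ 2

theorem Hr_mono {a b : ℕ} (h : a ≤ b) : Hr a ≤ Hr b := by
  apply Finset.sum_le_sum_of_subset_of_nonneg
  · intro x hx; simp at hx ⊢; omega
  · intros; positivity

theorem Hr_nonneg (n : ℕ) : 0 ≤ Hr n := Finset.sum_nonneg (by intros; positivity)

section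
open Polynomial

/-- value and derivative bound at one -/
def LB (p : ℝ[X]) (a h : ℝ) : Prop := |p.eval 1| ≤ a ∧ |p.derivative.eval 1| ≤ a * h

theorem LB.mul {p q : ℝ[X]} {a h b k : ℝ} (hp : LB p a h) (hq : LB q b k) :
    LB (p * q) (a * b) (h + k) := by
  obtain ⟨h1, h2⟩ := hp
  obtain ⟨h3, h4⟩ := hq
  have ha : 0 ≤ a := (abs_nonneg _).trans h1
  have hb : 0 ≤ b := (abs_nonneg _).trans h3
  constructor
  · rw [eval_mul, abs_mul]
    exact mul_le_mul h1 h3 (abs_nonneg _) ha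
  · rw [derivative_mul, eval_add, eval_mul, eval_mul]
    refine (abs_add_le _ _).trans ?_
    rw [abs_mul, abs_mul]
    have e1 := mul_le_mul h2 h3 (abs_nonneg _) ((abs_nonneg _).trans h2)
    have e2 := mul_le_mul h1 h4 (abs_nonneg _) ha
    nlinarith

theorem LB.prod {ι : Type*} (s : Finset ι) (p : ι → ℝ[X]) (a h : ι → ℝ)
    (H : ∀ i ∈ s, LB (p i) (a i) (h i)) : LB (∏ i ∈ s, p i) (∏ i ∈ s, a i) (∑ i ∈ s, h i) := by
  classical
  induction s using Finset.induction_on with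
  | empty => simp [LB]
  | insert x s hx ih =>
    rw [Finset.prod_insert hx, Finset.prod_insert hx, Finset.sum_insert hx]
    exact (H x (Finset.mem_insert_self _ _)).mul
      (ih (fun i hi => H i (Finset.mem_insert_of_mem hi)))

theorem prod_fact (k : ℕ) : ∏ l ∈ Finset.range k, ((l : ℝ) + 1) = k.factorial := by
  rw [← Finset.prod_range_add_one_eq_factorial]
  push_cast
  rfl

theorem LB_R (k i : ℕ) : LB (∏ l ∈ Finset.range k,
    (X - C (((i : ℕ) : ℝ) - ((i + l : ℕ) : ℝ)))) k.factorial (Hr k) := by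
  rw [← prod_fact]
  apply LB.prod
  intro l _
  have : (0:ℝ) < l + 1 := by positivity
  constructor
  · simp
    rw [add_comm, abs_of_pos this]
  · simp
    rw [mul_inv_cancel₀ this.ne']

theorem LB_D (k j : ℕ) : LB (∏ l ∈ Finset.range k,
    (X - C (((j + 2 + l : ℕ) : ℝ) - ((j : ℕ) : ℝ)))) k.factorial (Hr k) := by
  rw [← prod_fact]
  apply LB.prod
  intro l _
  have : (0:ℝ) < l + 1 := by positivity
  constructor
  · simp
    rw [show (1:ℝ) - (j + 2 + l - j) = -(l + 1) by ring, abs_neg, abs_of_pos this]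
  · simp
    rw [mul_inv_cancel₀ this.ne']

theorem cp_factor {n : ℕ} (μ : YD n) : ∃ Q : ℝ[X], cp μ.1 = (X - 1) ^ mm μ.1 * Q ∧
    LB Q (Pf μ.1) ((2 * mm μ.1 + 1 : ℕ) * Hr n) := by
  refine ⟨(∏ i ∈ Finset.range (mm μ.1 + 1), ∏ l ∈ Finset.range (μ.1.rowLen i - i),
      (X - C (((i : ℕ) : ℝ) - ((i + l : ℕ) : ℝ)))) *
      ∏ j ∈ Finset.range (mm μ.1), ∏ l ∈ Finset.range (μ.1.colLen j - j - 2),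
      (X - C (((j + 2 + l : ℕ) : ℝ) - ((j : ℕ) : ℝ))), ?_, ?_⟩
  · rw [cp, prod_cells]
    congr 1
    rw [Finset.prod_congr rfl (g := fun _ => X - 1), Finset.prod_const, Finset.card_range]
    intro t _
    simp
  · have h1 := LB.mul (LB.prod (Finset.range (mm μ.1 + 1)) _ _ _
        (fun i _ => LB_R (μ.1.rowLen i - i) i)) (LB.prod (Finset.range (mm μ.1)) _ _ _
        (fun j _ => LB_D (μ.1.colLen j - j - 2) j))
    have hP : (Pf μ.1 : ℝ) = (∏ i ∈ Finset.range (mm μ.1 + 1), ((μ.1.rowLen i - i).factorial : ℝ)) *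
        ∏ j ∈ Finset.range (mm μ.1), ((μ.1.colLen j - j - 2).factorial : ℝ) := by
      rw [Pf, idx, Finset.prod_disjSum]
      push_cast
      rfl
    rw [← hP] at h1
    refine ⟨h1.1, h1.2.trans ?_⟩
    apply mul_le_mul_of_nonneg_left _ (Nat.cast_nonneg _)
    have hb : ∀ x ∈ idx (mm μ.1), gg μ.1 x ≤ n := by
      intro x hx
      have := sum_gg μ.1
      rw [μ.2] at this
      have := Finset.single_le_sum (f := gg μ.1) (fun _ _ => Nat.zero_le _) hx
      omega
    have := Finset.sum_le_card_nsmul (idx (mm μ.1)) (fun x => Hr (gg μ.1 x)) (Hr n)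
      (fun x hx => Hr_mono (hb x hx))
    rw [card_idx, nsmul_eq_mul, idx, Finset.sum_disjSum] at this
    exact this

theorem dcp1 {n : ℕ} (μ : YD n) (h : mm μ.1 = 1) : |(cp μ.1).derivative.eval 1| ≤ Pf μ.1 ∧
    |(cp μ.1).derivative.derivative.eval 1| ≤ 6 * Hr n * Pf μ.1 := by
  obtain ⟨Q, h1, h2, h3⟩ := cp_factor μ
  rw [h] at h1 h3
  rw [h1]
  constructor
  · simpa [derivative_mul] using h2
  · have : (derivative (derivative ((X - 1) ^ 1 * Q))).eval 1 = 2 * Q.derivative.eval 1 := by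
      simp [derivative_mul]; ring
    rw [this, abs_mul, abs_two]
    norm_num at h3
    nlinarith

theorem dcp2 {n : ℕ} (μ : YD n) (h : mm μ.1 = 2) : (cp μ.1).derivative.eval 1 = 0 ∧
    |(cp μ.1).derivative.derivative.eval 1| ≤ 2 * Pf μ.1 := by
  obtain ⟨Q, h1, h2, h3⟩ := cp_factor μ
  rw [h] at h1
  rw [h1]
  constructor
  · simp [derivative_mul, pow_two]
  · have : (derivative (derivative ((X - 1) ^ 2 * Q))).eval 1 = 2 * Q.eval 1 := by
      simp [derivative_mul, pow_two]; norm_num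
    rw [this, abs_mul, abs_two]
    nlinarith

theorem dcp3 {n : ℕ} (μ : YD n) (h : 3 ≤ mm μ.1) : (cp μ.1).derivative.eval 1 = 0 ∧
    (cp μ.1).derivative.derivative.eval 1 = 0 := by
  obtain ⟨Q, h1, h2, h3⟩ := cp_factor μ
  obtain ⟨k, hk⟩ := Nat.exists_eq_add_of_le h
  rw [hk, pow_add, mul_assoc] at h1
  rw [h1]
  constructor
  · simp [derivative_mul, pow_succ]
  · simp [derivative_mul, pow_succ]

theorem dcp0 {n : ℕ} (μ : YD n) (h : mm μ.1 = 0) : (cp μ.1).derivative.eval 1 = n.factorial * Hr n ∧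
    (cp μ.1).derivative.derivative.eval 1 = n.factorial * (Hr n ^ 2 - Hr2 n) := by
  have hr : μ.1.rowLen 0 = n := by
    have := sum_gg μ.1
    rw [h, μ.2, idx, Finset.sum_disjSum] at this
    simpa [gg] using this
  have hc : cp μ.1 = ∏ l ∈ Finset.range n, (X + C (l : ℝ)) := by
    rw [cp, prod_cells, h]
    simp [hr]
  rw [hc]
  clear hc hr h
  have key : ∀ n : ℕ, (∏ l ∈ Finset.range n, (X + C (l : ℝ)) : ℝ[X]).eval 1 = (n.factorial : ℝ) ∧
    (∏ l ∈ Finset.range n, (X + C (l : ℝ)) : ℝ[X]).derivative.eval 1 = n.factorial * Hr n ∧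
    (∏ l ∈ Finset.range n, (X + C (l : ℝ)) : ℝ[X]).derivative.derivative.eval 1
      = n.factorial * (Hr n ^ 2 - Hr2 n) := by
    intro n
    induction n with
    | zero => simp [Hr, Hr2]
    | succ n ih =>
      obtain ⟨i1, i2, i3⟩ := ih
      have e1 : Hr (n+1) = Hr n + 1 / ((n:ℝ) + 1) := Finset.sum_range_succ _ _
      have e2 : Hr2 (n+1) = Hr2 n + 1 / ((n:ℝ) + 1) ^ 2 := Finset.sum_range_succ _ _
      have hn : (n:ℝ) + 1 ≠ 0 := by positivity
      rw [Finset.prod_range_succ, Nat.factorial_succ]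
      push_cast
      refine ⟨?_, ?_, ?_⟩
      · rw [eval_mul, i1]; simp; ring
      · rw [derivative_mul, eval_add, eval_mul, eval_mul, i1, i2, e1]
        simp
        field_simp
        ring
      · simp only [derivative_mul, derivative_add, derivative_X, derivative_C, eval_add, eval_mul,
          i1, i2, i3, e1, e2, derivative_one, derivative_zero, eval_X, eval_C, eval_one, eval_zero,
          add_zero, mul_one, mul_zero]
        field_simp
        ring
  exact (key n).2

end

/-- the one-row diagram -/
def oneRow (n : ℕ) : YD n := ⟨⟨{0} ×ˢ Finset.range n, by
  rintro ⟨a, b⟩ ⟨c, d⟩ h hx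
  rw [Prod.mk_le_mk] at h
  simp at hx ⊢
  omega⟩, by simp⟩

theorem mm_oneRow (n : ℕ) : mm (oneRow n).1 = 0 := by
  by_contra h
  have := (mem_mm (oneRow n).1 0).2 (by omega)
  rw [← YoungDiagram.mem_cells] at this
  simp [oneRow] at this

theorem eq_oneRow {n : ℕ} (μ : YD n) (h : mm μ.1 = 0) : μ = oneRow n := by
  have key : ∀ ν : YD n, mm ν.1 = 0 → gg ν.1 = fun x => if x = Sum.inl 0 then n else 0 := by
    intro ν hν
    have := gg_mem ν
    rw [Finset.mem_piAntidiag] at this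
    obtain ⟨h1, h2⟩ := this
    rw [hν] at h1 h2
    have hs : idx 0 = {Sum.inl 0} := by decide
    rw [hs] at h1 h2
    simp only [Finset.sum_singleton, Finset.mem_singleton, Nat.sub_zero] at h1 h2
    funext x
    split_ifs with hx
    · rw [hx, h1]
    · by_contra hc
      exact hx (h2 x hc)
  exact Subtype.ext (gg_inj _ _ (h.trans (mm_oneRow n).symm)
    ((key _ h).trans (key _ (mm_oneRow n)).symm))

/-- splitting of sums over diagrams -/
theorem sum_bound (n : ℕ) (f : YD n → ℝ) (A B c : ℝ) (h0 : f (oneRow n) = c)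
    (h1 : ∀ μ : YD n, mm μ.1 = 1 → |f μ| ≤ A * Pf μ.1)
    (h2 : ∀ μ : YD n, mm μ.1 = 2 → |f μ| ≤ B * Pf μ.1)
    (h3 : ∀ μ : YD n, 3 ≤ mm μ.1 → f μ = 0) (hA : 0 ≤ A) (hB : 0 ≤ B) :
    |∑ μ, f μ - c| ≤ A * (27 * (n - 1).factorial) + B * (243 * (n - 2).factorial) := by
  classical
  have hpt : ∀ μ : YD n, |f μ - if μ = oneRow n then c else 0| ≤
      A * (if mm μ.1 = 1 then (Pf μ.1 : ℝ) else 0) + B * (if mm μ.1 = 2 then (Pf μ.1 : ℝ) else 0) := by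
    intro μ
    by_cases hm : μ = oneRow n
    · have := mm_oneRow n
      rw [hm]
      simp [h0, this]
    · have hm0 : mm μ.1 ≠ 0 := fun h => hm (eq_oneRow μ h)
      rw [if_neg hm, sub_zero]
      rcases (by omega : mm μ.1 = 1 ∨ mm μ.1 = 2 ∨ 3 ≤ mm μ.1) with h | h | h
      · simpa [h] using h1 μ h
      · simpa [h] using h2 μ h
      · rw [h3 μ h, if_neg (by omega), if_neg (by omega)]; simp
  have e : ∑ μ, f μ - c = ∑ μ, (f μ - if μ = oneRow n then c else 0) := by
    rw [Finset.sum_sub_distrib]; simp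
  rw [e]
  refine (Finset.abs_sum_le_sum_abs _ _).trans ((Finset.sum_le_sum fun μ _ => hpt μ).trans ?_)
  rw [Finset.sum_add_distrib, ← Finset.mul_sum, ← Finset.mul_sum, ← Finset.sum_filter,
    ← Finset.sum_filter]
  have b1 := sum_Pf_le n 1
  have b2 := sum_Pf_le n 2
  norm_num at b1 b2
  have b1' : (∑ μ : YD n with mm μ.1 = 1, (Pf μ.1 : ℝ)) ≤ 27 * (n-1).factorial := by exact_mod_cast b1
  have b2' : (∑ μ : YD n with mm μ.1 = 2, (Pf μ.1 : ℝ)) ≤ 243 * (n-2).factorial := by exact_mod_cast b2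
  gcongr

theorem expect_C (n : ℕ) :
    expect n (fun p => (numCycles (p.1 * p.2 * p.1⁻¹ * p.2⁻¹) : ℝ)) =
      (∑ μ : YD n, (cp μ.1).derivative.eval 1) / n.factorial := by
  have h := congrArg (fun q => (Polynomial.derivative q).eval 1) (main_poly n)
  simp only [Polynomial.derivative_sum, Polynomial.eval_finsetSum, Polynomial.derivative_C_mul,
    Polynomial.eval_mul, Polynomial.eval_C, Polynomial.derivative_X_pow, Polynomial.eval_pow,
    Polynomial.eval_X, one_pow, mul_one] at h
  rw [expect, h]
  have : (n.factorial : ℝ) ≠ 0 := by positivity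
  field_simp

theorem expect_C2 (n : ℕ) :
    expect n (fun p => (numCycles (p.1 * p.2 * p.1⁻¹ * p.2⁻¹) : ℝ) *
      ((numCycles (p.1 * p.2 * p.1⁻¹ * p.2⁻¹) : ℝ) - 1)) =
      (∑ μ : YD n, (cp μ.1).derivative.derivative.eval 1) / n.factorial := by
  have h := congrArg (fun q => (Polynomial.derivative (Polynomial.derivative q)).eval 1) (main_poly n)
  have hX : ∀ k : ℕ, (Polynomial.derivative (Polynomial.derivative
      ((Polynomial.X : Polynomial ℝ) ^ k))).eval 1 = (k : ℝ) * ((k : ℝ) - 1) := by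
    intro k
    rcases k with _ | k
    · simp
    · simp [Polynomial.derivative_X_pow]
  simp only [Polynomial.derivative_sum, Polynomial.eval_finsetSum, Polynomial.derivative_C_mul,
    Polynomial.eval_mul, Polynomial.eval_C, hX] at h
  rw [expect, h]
  have : (n.factorial : ℝ) ≠ 0 := by positivity
  field_simp

theorem e1_bound (n : ℕ) (hn : 2 ≤ n) :
    |expect n (fun p => (numCycles (p.1 * p.2 * p.1⁻¹ * p.2⁻¹) : ℝ)) - Hr n| ≤ 27 / n := by
  have := sum_bound n (fun μ => (cp μ.1).derivative.eval 1) 1 0 (n.factorial * Hr n)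
    (dcp0 _ (mm_oneRow n)).1 (fun μ h => by simpa using (dcp1 μ h).1)
    (fun μ h => by simp [(dcp2 μ h).1]) (fun μ h => (dcp3 μ h).1) zero_le_one le_rfl
  rw [expect_C]
  have hf : (0:ℝ) < n.factorial := by positivity
  have hn0 : (0:ℝ) < n := by positivity
  have e : (n.factorial : ℝ) = n * (n-1).factorial := by
    exact_mod_cast (Nat.mul_factorial_pred (by omega)).symm
  have e2 : ∀ S : ℝ, S / n.factorial - Hr n = (S - n.factorial * Hr n) / n.factorial := by
    intro S; field_simp
  rw [e2, abs_div, abs_of_pos hf, div_le_div_iff₀ hf hn0]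
  rw [e] at this ⊢
  nlinarith

theorem e2_bound (n : ℕ) (hn : 2 ≤ n) :
    |expect n (fun p => (numCycles (p.1 * p.2 * p.1⁻¹ * p.2⁻¹) : ℝ) *
      ((numCycles (p.1 * p.2 * p.1⁻¹ * p.2⁻¹) : ℝ) - 1)) - (Hr n ^ 2 - Hr2 n)|
      ≤ 162 * (Hr n / n) + 486 / n := by
  have := sum_bound n (fun μ => (cp μ.1).derivative.derivative.eval 1) (6 * Hr n) 2
    (n.factorial * (Hr n ^ 2 - Hr2 n))
    (dcp0 _ (mm_oneRow n)).2 (fun μ h => (dcp1 μ h).2)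
    (fun μ h => (dcp2 μ h).2) (fun μ h => (dcp3 μ h).2)
    (mul_nonneg (by norm_num) (Hr_nonneg n)) zero_le_two
  rw [expect_C2]
  have hf : (0:ℝ) < n.factorial := by positivity
  have hn0 : (0:ℝ) < n := by positivity
  have e : (n.factorial : ℝ) = n * (n-1).factorial := by
    exact_mod_cast (Nat.mul_factorial_pred (by omega)).symm
  have e3 : ((n-2).factorial : ℝ) ≤ (n-1).factorial := by
    exact_mod_cast Nat.factorial_le (by omega)
  have e2 : ∀ S c : ℝ, S / n.factorial - c = (S - n.factorial * c) / n.factorial := by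
    intro S c; field_simp
  rw [e2, abs_div, abs_of_pos hf, div_le_iff₀ hf]
  refine this.trans ?_
  have : (162 * (Hr n / n) + 486 / n) * (n.factorial : ℝ) = 162 * Hr n * (n-1).factorial + 486 * (n-1).factorial := by
    rw [e]; field_simp
  rw [this]
  nlinarith
end

open Equiv

theorem var_eq (n : ℕ) : expect n (fun p => (genusRV n p - expect n (genusRV n)) ^ 2) =
    (expect n (fun p => (numCycles (p.1 * p.2 * p.1⁻¹ * p.2⁻¹) : ℝ) *
      ((numCycles (p.1 * p.2 * p.1⁻¹ * p.2⁻¹) : ℝ) - 1)) +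
      expect n (fun p => (numCycles (p.1 * p.2 * p.1⁻¹ * p.2⁻¹) : ℝ)) -
      expect n (fun p => (numCycles (p.1 * p.2 * p.1⁻¹ * p.2⁻¹) : ℝ)) ^ 2) / 4 := by
  unfold genusRV
  have key : ∀ c : Perm (Fin n) × Perm (Fin n) → ℝ,
      expect n (fun p => (((n:ℝ) / 2 - c p / 2 + 1) - expect n (fun p => (n:ℝ) / 2 - c p / 2 + 1)) ^ 2)
      = (expect n (fun p => c p * (c p - 1)) + expect n c - expect n c ^ 2) / 4 := by
    intro c
    have hf : ((n.factorial : ℝ)) ^ 2 ≠ 0 := by positivity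
    have hadd : ∀ f g, expect n (fun p => f p + g p) = expect n f + expect n g := by
      intro f g; simp only [expect, Finset.sum_add_distrib, add_div]
    have hmul : ∀ (a : ℝ) f, expect n (fun p => a * f p) = a * expect n f := by
      intro a f; simp only [expect, ← Finset.mul_sum, mul_div_assoc]
    have hone : ∀ a : ℝ, expect n (fun _ => a) = a := by
      intro a
      simp only [expect, Finset.sum_const, Finset.card_univ, Fintype.card_prod, Fintype.card_perm,
        Fintype.card_fin, nsmul_eq_mul]
      push_cast
      field_simp
    have hE : expect n (fun p => (n:ℝ) / 2 - c p / 2 + 1) = (n:ℝ)/2 + 1 + (-1/2) * expect n c := by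
      rw [← hmul, ← hone ((n:ℝ)/2 + 1), ← hadd]
      congr 1; funext p; ring
    rw [hE]
    have h2 : (fun p => (((n:ℝ) / 2 - c p / 2 + 1) - ((n:ℝ)/2 + 1 + (-1/2) * expect n c)) ^ 2) =
        fun p => ((1/4) * (c p * (c p - 1)) + (1/4 - expect n c / 2) * c p) + (expect n c)^2/4 := by
      funext p; ring
    rw [h2, hadd, hadd, hmul, hmul, hone]
    ring
  exact key (fun p => (numCycles (p.1 * p.2 * p.1⁻¹ * p.2⁻¹) : ℝ))

theorem tendsto_Hr : Filter.Tendsto (fun n : ℕ => Hr n - Real.log n) Filter.atTop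
    (nhds Real.eulerMascheroniConstant) := by
  have := Real.tendsto_harmonic_sub_log
  convert this using 3 with n
  simp [Hr, harmonic]

theorem tendsto_Hr2 : Filter.Tendsto Hr2 Filter.atTop (nhds (Real.pi ^ 2 / 6)) := by
  have h := hasSum_zeta_two
  have h2 := (hasSum_nat_add_iff' 1).2 h
  simp only [Finset.range_one, Finset.sum_singleton, Nat.cast_zero, ne_eq, OfNat.ofNat_ne_zero,
    not_false_eq_true, zero_pow, div_zero, sub_zero] at h2
  have := h2.tendsto_sum_nat
  push_cast at this
  exact this

theorem tendsto_Hr_div : Filter.Tendsto (fun n : ℕ => Hr n / n) Filter.atTop (nhds 0) := by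
  have h1 : Filter.Tendsto (fun n : ℕ => Real.log n / n) Filter.atTop (nhds 0) := by
    have := (Real.isLittleO_log_id_atTop.tendsto_div_nhds_zero).comp tendsto_natCast_atTop_atTop
    exact this
  have h2 := (tendsto_Hr.mul (tendsto_one_div_atTop_nhds_zero_nat (𝕜 := ℝ))).add h1
  rw [mul_zero, zero_add] at h2
  refine h2.congr (fun n => ?_)
  ring

/-- `Var[G_n] = log(n)/4 + γ/4 - π²/24 + o(1)`. -/
theorem genus_variance :
    Filter.Tendsto (fun n : ℕ =>
        expect n (fun p => (genusRV n p - expect n (genusRV n)) ^ 2) - Real.log n / 4)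
      Filter.atTop
      (nhds (Real.eulerMascheroniConstant / 4 - Real.pi ^ 2 / 24)) := by
  simp only [var_eq]
  set E1 : ℕ → ℝ := fun n => expect n (fun p => (numCycles (p.1 * p.2 * p.1⁻¹ * p.2⁻¹) : ℝ)) with hE1
  set E2 : ℕ → ℝ := fun n => expect n (fun p => (numCycles (p.1 * p.2 * p.1⁻¹ * p.2⁻¹) : ℝ) *
      ((numCycles (p.1 * p.2 * p.1⁻¹ * p.2⁻¹) : ℝ) - 1)) with hE2
  have hinv : Filter.Tendsto (fun n : ℕ => 1 / (n:ℝ)) Filter.atTop (nhds 0) :=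
    tendsto_one_div_atTop_nhds_zero_nat
  have t1 : Filter.Tendsto (fun n => E1 n - Hr n) Filter.atTop (nhds 0) := by
    apply squeeze_zero_norm' (a := fun n : ℕ => 27 * (1 / (n:ℝ)))
    · filter_upwards [Filter.eventually_ge_atTop 2] with n hn
      rw [Real.norm_eq_abs]
      refine (e1_bound n hn).trans (le_of_eq ?_)
      ring
    · simpa using hinv.const_mul 27
  have t2 : Filter.Tendsto (fun n => Hr n * (E1 n - Hr n)) Filter.atTop (nhds 0) := by
    apply squeeze_zero_norm' (a := fun n : ℕ => 27 * (Hr n / (n:ℝ)))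
    · filter_upwards [Filter.eventually_ge_atTop 2] with n hn
      rw [Real.norm_eq_abs, abs_mul, abs_of_nonneg (Hr_nonneg n)]
      refine (mul_le_mul_of_nonneg_left (e1_bound n hn) (Hr_nonneg n)).trans (le_of_eq ?_)
      ring
    · simpa using tendsto_Hr_div.const_mul 27
  have t3 : Filter.Tendsto (fun n => E2 n - (Hr n ^ 2 - Hr2 n)) Filter.atTop (nhds 0) := by
    apply squeeze_zero_norm' (a := fun n : ℕ => 162 * (Hr n / (n:ℝ)) + 486 * (1 / (n:ℝ)))
    · filter_upwards [Filter.eventually_ge_atTop 2] with n hn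
      rw [Real.norm_eq_abs]
      refine (e2_bound n hn).trans (le_of_eq ?_)
      ring
    · simpa using (tendsto_Hr_div.const_mul 162).add (hinv.const_mul 486)
  have T := (((((tendsto_Hr.sub tendsto_Hr2).add t3).add t1).sub (t2.const_mul 2)).sub
    (t1.pow 2)).div_const 4
  have hl : (Real.eulerMascheroniConstant - Real.pi ^ 2 / 6 + 0 + 0 - 2 * 0 - 0 ^ 2) / 4 =
    Real.eulerMascheroniConstant / 4 - Real.pi ^ 2 / 24 := by ring
  rw [hl] at T
  refine T.congr (fun n => ?_)
  ring
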